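/- Let p ≥ 7/32. For all r ∈ (0,1), √((r - r²)^p · K(1-r) · K(r)) ≤ K(1/2)/2^p, with equality if and only if r = 1/2. -/

import Mathlib

open Real Set Filter

noncomputable def K (x : ℝ) : ℝ :=
  ∫ t in (0 : ℝ)..(π / 2), (1 - x * Real.sin t ^ 2) ^ (-(1/2) : ℝ)

noncomputable def E (x : ℝ) : ℝ :=
  ∫ t in (0 : ℝ)..(π / 2), (1 - x * Real.sin t ^ 2) ^ ((1/2) : ℝ)

lemma aux_pos {x : ℝ} (hx : x < 1) (t : ℝ) : 0 < 1 - x * Real.sin t ^ 2 := by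
  have h1 := Real.sin_sq_le_one t
  have h0 := sq_nonneg (Real.sin t)
  rcases le_or_gt x 0 with h | h
  · nlinarith
  · nlinarith

lemma aux_cont (g : ℝ → ℝ) (hg : Continuous g) (a : ℝ) {x : ℝ} (hx : x < 1) :
    Continuous fun t => g t * (1 - x * Real.sin t ^ 2) ^ a := by
  refine hg.mul (Continuous.rpow_const (by fun_prop) ?_)
  intro t
  exact Or.inl (aux_pos hx t).ne'

lemma aux_deriv (g : ℝ → ℝ) (hg : Continuous g) (a : ℝ) {x : ℝ} (hx : x < 1) :
    HasDerivAt (fun x => ∫ t in (0 : ℝ)..(π / 2), g t * (1 - x * Real.sin t ^ 2) ^ a)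
      (∫ t in (0 : ℝ)..(π / 2), (-a * Real.sin t ^ 2 * g t) * (1 - x * Real.sin t ^ 2) ^ (a - 1)) x := by
  obtain ⟨y, hxy, hy⟩ := exists_between hx
  -- compact set of parameters
  let s : Set (ℝ × ℝ) := Icc (x - 1) y ×ˢ Icc 0 (π / 2)
  have hs : IsCompact s := isCompact_Icc.prod isCompact_Icc
  have hc : ContinuousOn (fun z : ℝ × ℝ =>
      (-a * Real.sin z.2 ^ 2 * g z.2) * (1 - z.1 * Real.sin z.2 ^ 2) ^ (a - 1)) s := by
    refine ContinuousOn.mul (by fun_prop) (ContinuousOn.rpow_const (by fun_prop) ?_)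
    intro z hz
    exact Or.inl (aux_pos (lt_of_le_of_lt hz.1.2 hy) z.2).ne'
  obtain ⟨C, hC⟩ := hs.exists_bound_of_continuousOn hc
  have hpi := Real.pi_pos
  refine (intervalIntegral.hasDerivAt_integral_of_dominated_loc_of_deriv_le
    (F := fun x t => g t * (1 - x * Real.sin t ^ 2) ^ a)
    (F' := fun x t => (-a * Real.sin t ^ 2 * g t) * (1 - x * Real.sin t ^ 2) ^ (a - 1))
    (bound := fun _ => C) (s := Ioo (x - 1) y) (Ioo_mem_nhds (by linarith) hxy)
    ?_ ?_ ?_ ?_ ?_ ?_).2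
  · filter_upwards [Iio_mem_nhds hx] with z hz
    exact (aux_cont g hg a hz).aestronglyMeasurable
  · exact (aux_cont g hg a hx).intervalIntegrable _ _
  · exact (aux_cont (fun t => -a * Real.sin t ^ 2 * g t) (by fun_prop) _ hx).aestronglyMeasurable
  · refine Eventually.of_forall fun t ht z hz => ?_
    rw [uIoc_of_le (by positivity)] at ht
    exact hC (z, t) ⟨⟨hz.1.le, hz.2.le⟩, ⟨ht.1.le, ht.2⟩⟩
  · exact intervalIntegrable_const
  · refine Eventually.of_forall fun t ht z hz => ?_
    have h1 : HasDerivAt (fun z : ℝ => 1 - z * Real.sin t ^ 2) (-(1 * Real.sin t ^ 2)) z :=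
      ((hasDerivAt_id z).mul_const _).const_sub 1
    have h2 := (h1.rpow_const (p := a) (Or.inl (aux_pos (hz.2.trans hy) t).ne')).const_mul (g t)
    exact h2.congr_deriv (by ring)

noncomputable def K1 (x : ℝ) : ℝ :=
  ∫ t in (0 : ℝ)..(π / 2), (1/2 * Real.sin t ^ 2) * (1 - x * Real.sin t ^ 2) ^ (-(3/2) : ℝ)

noncomputable def K2 (x : ℝ) : ℝ :=
  ∫ t in (0 : ℝ)..(π / 2), (3/4 * Real.sin t ^ 4) * (1 - x * Real.sin t ^ 2) ^ (-(5/2) : ℝ)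

lemma hasDerivAt_K {x : ℝ} (hx : x < 1) : HasDerivAt K (K1 x) x := by
  have h := aux_deriv (fun _ => 1) continuous_const (-(1/2)) hx
  have e1 : K = (fun x => ∫ t in (0 : ℝ)..(π / 2), 1 * (1 - x * Real.sin t ^ 2) ^ (-(1/2) : ℝ)) := by
    funext x; simp [K]
  rw [e1, K1]
  convert h using 1
  congr 1; funext t
  norm_num

lemma hasDerivAt_K1 {x : ℝ} (hx : x < 1) : HasDerivAt K1 (K2 x) x := by
  have h := aux_deriv (fun t => 1/2 * Real.sin t ^ 2) (by fun_prop) (-(3/2)) hx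
  change HasDerivAt (fun x => K1 x) _ _
  unfold K1
  rw [K2]
  convert h using 1
  congr 1; funext t
  norm_num
  left
  ring

lemma K_pos {x : ℝ} (hx : x < 1) : 0 < K x := by
  refine intervalIntegral.intervalIntegral_pos_of_pos ?_ (fun t => rpow_pos_of_pos (aux_pos hx t) _)
    (by positivity)
  have := aux_cont (fun _ => 1) continuous_const (-(1/2)) hx
  simp only [one_mul] at this
  exact this.intervalIntegrable _ _

lemma K1_nonneg {x : ℝ} (hx : x < 1) : 0 ≤ K1 x := by
  refine intervalIntegral.integral_nonneg (by positivity) (fun t _ => ?_)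
  have := rpow_pos_of_pos (aux_pos hx t) (-(3/2))
  positivity

lemma K_ode {x : ℝ} (hx : x < 1) : x * (1 - x) * K2 x + (1 - 2 * x) * K1 x = K x / 4 := by
  have c0 := aux_cont (fun _ => 1) continuous_const (-(1/2)) hx
  have c1 := aux_cont (fun t => 1/2 * Real.sin t ^ 2) (by fun_prop) (-(3/2)) hx
  have c2 := aux_cont (fun t => 3/4 * Real.sin t ^ 4) (by fun_prop) (-(5/2)) hx
  have key : ∀ t, HasDerivAt
      (fun t => -(1/4) * (Real.sin t * Real.cos t * (1 - x * Real.sin t ^ 2) ^ (-(3/2) : ℝ)))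
      (x * (1 - x) * ((3/4 * Real.sin t ^ 4) * (1 - x * Real.sin t ^ 2) ^ (-(5/2) : ℝ))
        + (1 - 2 * x) * ((1/2 * Real.sin t ^ 2) * (1 - x * Real.sin t ^ 2) ^ (-(3/2) : ℝ))
        - 1/4 * (1 * (1 - x * Real.sin t ^ 2) ^ (-(1/2) : ℝ))) t := by
    intro t
    have hp := aux_pos hx t
    have h1 : HasDerivAt (fun t : ℝ => 1 - x * Real.sin t ^ 2)
        (-(x * (2 * Real.sin t * Real.cos t))) t := by
      have := (((Real.hasDerivAt_sin t).pow 2).const_mul x).const_sub 1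
      exact this.congr_deriv (by norm_num)
    have h2 := h1.rpow_const (p := -(3/2)) (Or.inl hp.ne')
    have h3 := (((Real.hasDerivAt_sin t).mul (Real.hasDerivAt_cos t)).mul h2).const_mul (-(1/4))
    refine h3.congr_deriv ?_
    have e1 : (1 - x * Real.sin t ^ 2) ^ (-(3/2) : ℝ)
        = (1 - x * Real.sin t ^ 2) * (1 - x * Real.sin t ^ 2) ^ (-(5/2) : ℝ) := by
      rw [← Real.rpow_one_add' hp.le (by norm_num)]; norm_num
    have e2 : (1 - x * Real.sin t ^ 2) ^ (-(1/2) : ℝ)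
        = (1 - x * Real.sin t ^ 2) ^ 2 * (1 - x * Real.sin t ^ 2) ^ (-(5/2) : ℝ) := by
      rw [← Real.rpow_natCast (1 - x * Real.sin t ^ 2) 2, ← Real.rpow_add hp]; norm_num
    have e3 : (-(3/2) - 1 : ℝ) = -(5/2) := by norm_num
    simp only [Pi.mul_apply]
    rw [e3, e1, e2]
    generalize (1 - x * Real.sin t ^ 2) ^ (-(5/2) : ℝ) = R
    have hcs : Real.cos t ^ 2 = 1 - Real.sin t ^ 2 := by
      have := Real.sin_sq_add_cos_sq t; linarith
    generalize Real.sin t = S at *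
    generalize Real.cos t = C at *
    linear_combination (-(1/4) * (1 - x * S^2) * R - 3/4 * x * S^2 * R) * hcs
  have i0 := (c0.const_mul (1/4)).intervalIntegrable (μ := MeasureTheory.volume) 0 (π/2)
  have i1 := (c1.const_mul (1 - 2 * x)).intervalIntegrable (μ := MeasureTheory.volume) 0 (π/2)
  have i2 := (c2.const_mul (x * (1 - x))).intervalIntegrable (μ := MeasureTheory.volume) 0 (π/2)
  have h := intervalIntegral.integral_eq_sub_of_hasDerivAt (fun t _ => key t) ((i2.add i1).sub i0)
  rw [intervalIntegral.integral_sub (i2.add i1) i0, intervalIntegral.integral_add i2 i1,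
    intervalIntegral.integral_const_mul, intervalIntegral.integral_const_mul,
    intervalIntegral.integral_const_mul] at h
  simp only [Real.sin_zero, Real.cos_pi_div_two, mul_zero, zero_mul, sub_zero, one_mul] at h
  change x * (1 - x) * K2 x + (1 - 2 * x) * K1 x - 1 / 4 * K x = 0 at h
  linarith

noncomputable def qq (x : ℝ) : ℝ := K1 x / K x
noncomputable def vv (x : ℝ) : ℝ := x * (1 - x) * qq x

lemma qq_nonneg {x : ℝ} (hx : x < 1) : 0 ≤ qq x := div_nonneg (K1_nonneg hx) (K_pos hx).le

lemma hasDerivAt_vv {x : ℝ} (hx : x < 1) :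
    HasDerivAt vv (1/4 - x * (1 - x) * qq x ^ 2) x := by
  have hK := K_pos hx
  have h1 : HasDerivAt (fun x : ℝ => x * (1 - x)) (1 * (1 - x) + x * (-1)) x :=
    (hasDerivAt_id x).mul ((hasDerivAt_id x).const_sub 1)
  have h2 := h1.mul ((hasDerivAt_K1 hx).div (hasDerivAt_K hx) hK.ne')
  have ho := K_ode hx
  refine h2.congr_deriv ?_
  simp only [qq, Pi.div_apply]
  field_simp
  linear_combination 4 * K x * ho

lemma hasDerivAt_vv' {x : ℝ} (hx : 0 < x) :
    HasDerivAt (fun x => vv (1 - x)) (-(1/4 - x * (1 - x) * qq (1 - x) ^ 2)) x := by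
  have h := (hasDerivAt_vv (x := 1 - x) (by linarith)).comp x ((hasDerivAt_id x).const_sub 1)
  exact h.congr_deriv (by ring)

/-- monotonicity helper -/
lemma anti_of_deriv {f f' : ℝ → ℝ} {a b : ℝ} (hab : a ≤ b)
    (hf : ∀ x ∈ Icc a b, HasDerivAt f (f' x) x) (h : ∀ x ∈ Ioo a b, f' x ≤ 0) : f b ≤ f a := by
  have := antitoneOn_of_deriv_nonpos (convex_Icc a b) (f := f)
    (fun x hx => (hf x hx).continuousAt.continuousWithinAt)
    (fun x hx => (hf x (interior_subset hx)).differentiableAt.differentiableWithinAt)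
    (fun x hx => by
      rw [(hf x (interior_subset hx)).deriv]
      rw [interior_Icc] at hx; exact h x hx)
  exact this (left_mem_Icc.2 hab) (right_mem_Icc.2 hab) hab

lemma anti_of_deriv_strict {f f' : ℝ → ℝ} {a b : ℝ} (hab : a < b)
    (hf : ∀ x ∈ Icc a b, HasDerivAt f (f' x) x) (h : ∀ x ∈ Ioo a b, f' x < 0) : f b < f a := by
  have := strictAntiOn_of_deriv_neg (convex_Icc a b) (f := f)
    (fun x hx => (hf x hx).continuousAt.continuousWithinAt)
    (fun x hx => by
      rw [(hf x (interior_subset hx)).deriv]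
      rw [interior_Icc] at hx; exact h x hx)
  exact this (left_mem_Icc.2 hab.le) (right_mem_Icc.2 hab.le) hab

lemma vv_le {x : ℝ} (h0 : 0 ≤ x) (hx : x < 1) : vv x ≤ x / 4 := by
  have := anti_of_deriv (f := fun x => vv x - x / 4) h0
    (fun y hy => (hasDerivAt_vv (hy.2.trans_lt hx)).sub ((hasDerivAt_id y).div_const 4))
    (fun y hy => by
      have : 0 ≤ y * (1 - y) * qq y ^ 2 :=
        mul_nonneg (mul_nonneg hy.1.le (by linarith [hy.2])) (sq_nonneg _)
      linarith)
  simp [vv] at this ⊢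
  linarith

lemma qq_half : 3/8 ≤ qq (1/2) := by
  have := anti_of_deriv (f := fun x => 3/16 * x - vv x) (a := 0) (b := 1/2) (by norm_num)
    (fun y hy => ((hasDerivAt_id y).const_mul (3/16)).sub
      (hasDerivAt_vv (hy.2.trans_lt (by norm_num))))
    (fun y hy => by
      obtain ⟨h0, h1⟩ := hy
      have hv := vv_le h0.le (by linarith)
      have hq := qq_nonneg (x := y) (by linarith)
      unfold vv at hv
      have hq2 : (1 - y) * qq y ≤ 1/4 := by
        by_contra hcon
        push Not at hcon
        nlinarith
      have hq3 : qq y ≤ 1/2 := by nlinarith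
      have hq4 : y * (1 - y) * qq y ^ 2 ≤ 1/16 := by
        have e : y * (1 - y) * qq y ^ 2 = y * (((1 - y) * qq y) * qq y) := by ring
        have e2 : ((1 - y) * qq y) * qq y ≤ 1/4 * (1/2) :=
          mul_le_mul hq2 hq3 hq (by norm_num)
        rw [e]
        have e3 : 0 ≤ ((1 - y) * qq y) * qq y :=
          mul_nonneg (mul_nonneg (by linarith) hq) hq
        nlinarith
      linarith)
  simp [vv] at this
  norm_num at this ⊢
  linarith

lemma DD_le {r : ℝ} (h0 : 1/2 ≤ r) (hr : r < 1) : vv r - vv (1 - r) ≤ r / 2 - 1/4 := by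
  have := anti_of_deriv (f := fun x => (vv x - vv (1 - x)) - x / 2) h0
    (fun y hy => ((hasDerivAt_vv (hy.2.trans_lt hr)).sub
      (hasDerivAt_vv' (by linarith [hy.1]))).sub ((hasDerivAt_id y).div_const 2))
    (fun y hy => by
      have hw : 0 ≤ y * (1 - y) := mul_nonneg (by linarith [hy.1]) (by linarith [hy.2])
      have := mul_nonneg hw (sq_nonneg (qq y))
      have := mul_nonneg hw (sq_nonneg (qq (1 - y)))
      linarith)
  norm_num at this
  linarith

lemma TT_ge {r : ℝ} (h0 : 1/2 ≤ r) (hr : r < 1) :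
    9/64 ≤ r * (1 - r) * (qq r + qq (1 - r)) ^ 2 := by
  have := anti_of_deriv (f := fun x => -((vv x + vv (1 - x)) ^ 2 / (x * (1 - x)))) h0
    (fun y hy => by
      have hw : 0 < y * (1 - y) := mul_pos (by linarith [hy.1]) (by linarith [hy.2])
      have h1 : HasDerivAt (fun x : ℝ => x * (1 - x)) (1 * (1 - y) + y * (-1)) y :=
        (hasDerivAt_id y).mul ((hasDerivAt_id y).const_sub 1)
      exact ((((hasDerivAt_vv (hy.2.trans_lt hr)).add
        (hasDerivAt_vv' (by linarith [hy.1]))).pow 2).div h1 hw.ne').neg)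
    (fun y hy => by
      have hy1 : y < 1 := by linarith [hy.2]
      have hw : 0 < y * (1 - y) := mul_pos (by linarith [hy.1]) (by linarith [hy.2])
      have hD := DD_le hy.1.le hy1
      rw [neg_nonpos]
      refine div_nonneg ?_ (sq_nonneg _)
      have e : vv (1 - y) = y * (1 - y) * qq (1 - y) := by unfold vv; ring
      have e' : vv y = y * (1 - y) * qq y := rfl
      have hs : 0 ≤ (vv y + vv (1 - y)) ^ 2 * (2 * y - 1 - 2 * (vv y - vv (1 - y))) :=
        mul_nonneg (sq_nonneg _) (by linarith [hy.1])
      refine hs.trans (le_of_eq ?_)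
      simp only [Pi.add_apply, Pi.pow_apply]
      rw [e, e']
      push_cast
      ring)
  have hw : 0 < r * (1 - r) := mul_pos (by linarith) (by linarith)
  have e : (vv r + vv (1 - r)) ^ 2 / (r * (1 - r)) = r * (1 - r) * (qq r + qq (1 - r)) ^ 2 := by
    unfold vv
    rw [div_eq_iff hw.ne']
    ring
  have hq := qq_half
  simp only [neg_le_neg_iff] at this
  rw [e] at this
  refine le_trans ?_ this
  unfold vv
  norm_num
  norm_num at hq
  nlinarith

lemma DD_lt {r : ℝ} (h0 : 1/2 < r) (hr : r < 1) :
    vv r - vv (1 - r) < 7/32 * (2 * r - 1) := by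
  have := anti_of_deriv_strict (f := fun x => (vv x - vv (1 - x)) - 7/16 * x) h0
    (fun y hy => ((hasDerivAt_vv (hy.2.trans_lt hr)).sub
      (hasDerivAt_vv' (by linarith [hy.1]))).sub ((hasDerivAt_id y).const_mul (7/16)))
    (fun y hy => by
      have hw : 0 ≤ y * (1 - y) := mul_nonneg (by linarith [hy.1]) (by linarith [hy.2])
      have hT := TT_ge hy.1.le (by linarith [hy.2])
      have := mul_nonneg hw (sq_nonneg (qq y - qq (1 - y)))
      nlinarith)
  norm_num at this
  linarith

lemma main_log (p : ℝ) (hp : p ≥ 7/32) {r : ℝ} (h0 : 1/2 < r) (hr : r < 1) :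
    p * Real.log (r * (1 - r)) + Real.log (K (1 - r)) + Real.log (K r)
      < p * Real.log (1/4) + 2 * Real.log (K (1/2)) := by
  have := anti_of_deriv_strict
    (f := fun r => p * Real.log (r * (1 - r)) + Real.log (K (1 - r)) + Real.log (K r)) h0
    (fun y hy => by
      have hw : 0 < y * (1 - y) := mul_pos (by linarith [hy.1]) (by linarith [hy.2])
      have h1 : HasDerivAt (fun x : ℝ => x * (1 - x)) (1 * (1 - y) + y * (-1)) y :=
        (hasDerivAt_id y).mul ((hasDerivAt_id y).const_sub 1)
      have hK' : HasDerivAt (fun x => K (1 - x)) (K1 (1 - y) * (-1)) y :=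
        (hasDerivAt_K (x := 1 - y) (by linarith [hy.1])).comp y ((hasDerivAt_id y).const_sub 1)
      exact (((h1.log hw.ne').const_mul p).add
        (hK'.log (K_pos (by linarith [hy.1])).ne')).add
        ((hasDerivAt_K (hy.2.trans_lt hr)).log (K_pos (hy.2.trans_lt hr)).ne'))
    (fun y hy => by
      have hw : 0 < y * (1 - y) := mul_pos (by linarith [hy.1]) (by linarith [hy.2])
      have hD := DD_lt hy.1 (by linarith [hy.2])
      have hp2 : 7/32 * (2 * y - 1) ≤ p * (2 * y - 1) :=
        mul_le_mul_of_nonneg_right hp (by linarith [hy.1])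
      have e : p * ((1 * (1 - y) + y * (-1)) / (y * (1 - y))) + K1 (1 - y) * (-1) / K (1 - y)
          + K1 y / K y = (vv y - vv (1 - y) - p * (2 * y - 1)) / (y * (1 - y)) := by
        have e1 : K1 (1 - y) * (-1) / K (1 - y) = - qq (1 - y) := by unfold qq; ring
        have e2 : K1 y / K y = qq y := rfl
        rw [e1, e2, eq_div_iff hw.ne', vv, vv, add_mul, add_mul, mul_assoc, div_mul_cancel₀ _ hw.ne']
        ring
      rw [e]
      exact div_neg_of_neg_of_pos (by linarith) hw)
  norm_num at this ⊢
  linarith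

lemma main_lt (p : ℝ) (hp : p ≥ 7/32) {r : ℝ} (h0 : 1/2 < r) (hr : r < 1) :
    Real.sqrt ((r - r ^ 2) ^ p * K (1 - r) * K r) < K (1/2) / 2 ^ p := by
  have hw : 0 < r * (1 - r) := mul_pos (by linarith) (by linarith)
  have hK := K_pos hr
  have hK' := K_pos (x := 1 - r) (by linarith)
  have hK0 := K_pos (x := 1/2) (by norm_num)
  have hl := main_log p hp h0 hr
  have e : r - r ^ 2 = r * (1 - r) := by ring
  rw [Real.sqrt_lt' (by positivity), e]
  have hwp := rpow_pos_of_pos hw p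
  have e4 : (K (1/2) / 2 ^ p) ^ 2 = (1/4 : ℝ) ^ p * K (1/2) ^ 2 := by
    rw [div_pow, ← Real.rpow_natCast (2 ^ p) 2, ← Real.rpow_mul (by norm_num), mul_comm p,
      Real.rpow_mul (by norm_num), Real.div_rpow (by norm_num) (by norm_num), Real.one_rpow]
    norm_num
    ring
  rw [e4]
  rw [← Real.log_lt_log_iff (by positivity) (by positivity), Real.log_mul (by positivity) hK.ne',
    Real.log_mul hwp.ne' hK'.ne', Real.log_rpow hw, Real.log_mul (x := (1/4 : ℝ) ^ p) (by positivity) (by positivity),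
    Real.log_rpow (by norm_num), Real.log_pow]
  exact_mod_cast hl

theorem stmt18 (p : ℝ) (hp : p ≥ 7/32) :
    ∀ r ∈ Ioo (0 : ℝ) 1,
      Real.sqrt ((r - r ^ 2) ^ p * K (1 - r) * K r) ≤ K (1/2) / 2 ^ p ∧
      (Real.sqrt ((r - r ^ 2) ^ p * K (1 - r) * K r) = K (1/2) / 2 ^ p ↔ r = 1/2) := by
  rintro r ⟨h0, h1⟩
  rcases lt_trichotomy r (1/2) with h | h | h
  · have := main_lt p hp (r := 1 - r) (by linarith) (by linarith)
    have e : (1 - r) - (1 - r) ^ 2 = r - r ^ 2 := by ring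
    rw [e, sub_sub_cancel, mul_right_comm] at this
    exact ⟨this.le, ⟨fun h' => absurd h' this.ne, fun h' => absurd h' h.ne⟩⟩
  · have hK0 := K_pos (x := 1/2) (by norm_num)
    have : Real.sqrt ((r - r ^ 2) ^ p * K (1 - r) * K r) = K (1/2) / 2 ^ p := by
      subst h
      rw [Real.sqrt_eq_iff_mul_self_eq_of_pos (by positivity)]
      have e1 : (1/2 - (1/2) ^ 2 : ℝ) = 1/2 * (1/2) := by norm_num
      have e2 : (1 - 1/2 : ℝ) = 1/2 := by norm_num
      rw [e1, e2, Real.mul_rpow (by norm_num) (by norm_num),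
        Real.div_rpow (by norm_num) (by norm_num), Real.one_rpow]
      ring
    exact ⟨this.le, ⟨fun _ => h, fun _ => this⟩⟩
  · have := main_lt p hp h h1
    exact ⟨this.le, ⟨fun h' => absurd h' this.ne, fun h' => absurd h' h.ne'⟩⟩
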